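/- arXiv:1305.3805 — 2 statements merged into one kernel-verified Lean document; each statement's English description precedes it below -/
import Mathlib

section
/- Let g_k(x) = e^{ik|x|}/(4π|x|) for x ∈ ℝ³ \ {0} with Im(k) > 0. Then ∫_{ℝ³} (e^{ik|x|}/|x|) · (e^{−i k̄ |x−y|}/|x−y|) d³x = (2π/Im(k)) e^{−Im(k)|y|} sin(Re(k)|y|)/(Re(k)|y|) for every y ∈ ℝ³ (interpreting sin(t)/t as 1 at t = 0). -/
open MeasureTheory
noncomputable section

abbrev E3 := EuclideanSpace ℝ (Fin 3)

lemma inner_hasDeriv (c : ℂ) (hc : c ≠ 0) (R r : ℝ) (hR : 0 < R) (z : ℝ)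
    (hz : 0 < r^2 - 2*R*z + R^2) :
    HasDerivAt (fun z : ℝ => -Complex.exp (c * (Real.sqrt (r^2 - 2*R*z + R^2) : ℝ)) / (R * c))
      (Complex.exp (c * (Real.sqrt (r^2 - 2*R*z + R^2) : ℝ)) / (Real.sqrt (r^2 - 2*R*z + R^2) : ℝ)) z := by
  have h1 : HasDerivAt (fun z : ℝ => r^2 - 2*R*z + R^2) (-(2*R)) z := by
    have := (((hasDerivAt_id z).const_mul (2*R)).const_sub (r^2)).add_const (R^2)
    simpa using this
  have h2 := (h1.sqrt hz.ne').ofReal_comp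
  have h3 := (((h2.const_mul c).cexp).neg).div_const ((R:ℂ) * c)
  refine h3.congr_deriv ?_
  have hs : (Real.sqrt (r^2 - 2*R*z + R^2) : ℂ) ≠ 0 := by
    exact_mod_cast (Real.sqrt_pos.2 hz).ne'
  have hR' : (R : ℂ) ≠ 0 := by exact_mod_cast hR.ne'
  push_cast
  field_simp

lemma s_pos {R r z : ℝ} (hR : 0 < R) (hrR : r ≠ R) (hz : z ≤ r) :
    0 < r^2 - 2*R*z + R^2 := by
  have : 0 < (r - R)^2 := by
    have : r - R ≠ 0 := sub_ne_zero.2 hrR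
    positivity
  nlinarith

lemma inner_ii (c : ℂ) (R r : ℝ) (hR : 0 < R) (hr : 0 < r) (hrR : r ≠ R) :
    IntervalIntegrable (fun z : ℝ => Complex.exp (c * (Real.sqrt (r^2 - 2*R*z + R^2) : ℝ)) /
      (Real.sqrt (r^2 - 2*R*z + R^2) : ℝ)) volume (-r) r := by
  apply ContinuousOn.intervalIntegrable
  apply ContinuousOn.div
  · fun_prop
  · fun_prop
  · intro z hz
    rw [Set.uIcc_of_le (by linarith)] at hz
    exact_mod_cast (Real.sqrt_pos.2 (s_pos hR hrR hz.2)).ne'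

lemma inner_int (c : ℂ) (hc : c ≠ 0) (R r : ℝ) (hR : 0 < R) (hr : 0 < r) (hrR : r ≠ R) :
    ∫ z in (-r)..r, Complex.exp (c * (Real.sqrt (r^2 - 2*R*z + R^2) : ℝ)) /
      (Real.sqrt (r^2 - 2*R*z + R^2) : ℝ) =
      (Complex.exp (c * (r + R : ℝ)) - Complex.exp (c * (|r - R| : ℝ))) / (R * c) := by
  rw [intervalIntegral.integral_eq_sub_of_hasDerivAt
    (fun z hz => inner_hasDeriv c hc R r hR z ?_) (inner_ii c R r hR hr hrR)]
  · have e1 : r^2 - 2*R*r + R^2 = (r-R)^2 := by ring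
    have e2 : r^2 - 2*R*(-r) + R^2 = (r+R)^2 := by ring
    rw [e1, e2, Real.sqrt_sq_eq_abs, Real.sqrt_sq (by linarith)]
    ring
  · rw [Set.uIcc_of_le (by linarith)] at hz
    exact s_pos hR hrR hz.2

lemma subst_r (z : ℝ) (h : ℝ → ENNReal) :
    ∫⁻ ρ in Set.Ioi (0:ℝ), ENNReal.ofReal ρ * h (Real.sqrt (ρ^2 + z^2)) =
    ∫⁻ r in Set.Ioi |z|, ENNReal.ofReal r * h r := by
  have him : (fun ρ : ℝ => Real.sqrt (ρ^2 + z^2)) '' Set.Ioi 0 = Set.Ioi |z| := by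
    ext r
    constructor
    · rintro ⟨ρ, hρ, rfl⟩
      have hρ : 0 < ρ := hρ
      rw [Set.mem_Ioi, ← Real.sqrt_sq_eq_abs]
      apply Real.sqrt_lt_sqrt (by positivity)
      have : 0 < ρ^2 := by positivity
      linarith
    · intro hr
      have hr : |z| < r := hr
      have h0 := abs_nonneg z
      have h1 : z^2 < r^2 := by rw [← sq_abs z]; nlinarith
      refine ⟨Real.sqrt (r^2 - z^2), Real.sqrt_pos.2 (by linarith), ?_⟩
      simp only
      rw [Real.sq_sqrt (by linarith), sub_add_cancel, Real.sqrt_sq (by linarith)]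
  rw [← him, lintegral_image_eq_lintegral_abs_deriv_mul (f' := fun ρ => ρ / Real.sqrt (ρ^2+z^2))
    measurableSet_Ioi]
  · apply setLIntegral_congr_fun measurableSet_Ioi
    intro ρ hρ
    have hρ : 0 < ρ := hρ
    have hs : 0 < Real.sqrt (ρ^2 + z^2) := Real.sqrt_pos.2 (by positivity)
    simp only
    rw [← mul_assoc, ← ENNReal.ofReal_mul (by positivity), abs_of_pos (by positivity),
      div_mul_cancel₀ _ hs.ne']
  · intro ρ hρ
    have hρ : 0 < ρ := hρ
    have h1 : HasDerivAt (fun ρ : ℝ => ρ^2 + z^2) (2*ρ) ρ := by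
      simpa using (hasDerivAt_pow 2 ρ).add_const (z^2)
    have := h1.sqrt (by positivity)
    apply HasDerivAt.hasDerivWithinAt
    refine this.congr_deriv ?_
    field_simp
  · intro a ha b hb hab
    have ha : 0 < a := ha
    have hb : 0 < b := hb
    simp only at hab
    rw [Real.sqrt_inj (by positivity) (by positivity)] at hab
    have : a^2 = b^2 := by linarith
    exact (pow_left_inj₀ ha.le hb.le two_ne_zero).1 this

lemma polar2 (g : ℝ → ENNReal) (hg : Measurable g) :
    ∫⁻ p : ℝ × ℝ, g (p.1^2 + p.2^2) =
    ENNReal.ofReal (2 * Real.pi) * ∫⁻ ρ in Set.Ioi (0:ℝ), ENNReal.ofReal ρ * g (ρ^2) := by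
  rw [← lintegral_comp_polarCoord_symm]
  have : ∀ p : ℝ × ℝ, (polarCoord.symm p).1^2 + (polarCoord.symm p).2^2 = p.1^2 := by
    intro p
    simp only [polarCoord_symm_apply]
    have := Real.sin_sq_add_cos_sq p.2
    linear_combination p.1^2 * this
  simp only [this]
  rw [polarCoord_target, Measure.volume_eq_prod, ← Measure.prod_restrict, lintegral_prod _ (by fun_prop)]
  simp only [lintegral_const, smul_eq_mul]
  rw [lintegral_mul_const _ (by fun_prop), mul_comm]
  congr 1
  rw [Measure.restrict_apply_univ, Real.volume_Ioo]
  congr 1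
  ring

lemma lint3 (h : ℝ × ℝ → ENNReal) (hh : Measurable h) :
    ∫⁻ x : E3, h (‖x‖, x 0) =
    ∫⁻ p : ℝ × ℝ, (({p : ℝ × ℝ | |p.2| < p.1}.indicator
      (fun p => ENNReal.ofReal (2 * Real.pi * p.1))) p) * h p := by
  have e1 : ∫⁻ x : E3, h (‖x‖, x 0) =
      ∫⁻ x : Fin 3 → ℝ, h (Real.sqrt (x 0 ^2 + (x 1^2 + x 2 ^2)), x 0) := by
    rw [← (PiLp.volume_preserving_ofLp (Fin 3)).lintegral_comp (by fun_prop)]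
    apply lintegral_congr
    intro x
    rw [EuclideanSpace.norm_eq, Fin.sum_univ_three]
    simp [add_assoc]
  have e2 : ∫⁻ x : Fin 3 → ℝ, h (Real.sqrt (x 0 ^2 + (x 1^2 + x 2 ^2)), x 0) =
      ∫⁻ q : ℝ × (Fin 2 → ℝ), h (Real.sqrt (q.1 ^2 + (q.2 0^2 + q.2 1 ^2)), q.1) := by
    rw [← (volume_preserving_piFinSuccAbove (fun _ : Fin 3 => ℝ) 0).lintegral_comp (by fun_prop)]
    rfl
  rw [e1, e2, Measure.volume_eq_prod, lintegral_prod _ (by fun_prop)]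
  have e3 : ∀ z : ℝ, ∫⁻ q : Fin 2 → ℝ, h (Real.sqrt (z ^2 + (q 0^2 + q 1 ^2)), z) =
     ∫⁻ r : ℝ, (({p : ℝ × ℝ | |p.2| < p.1}.indicator
      (fun p => ENNReal.ofReal (2 * Real.pi * p.1))) (r, z)) * h (r, z) := by
    intro z
    have a1 : ∫⁻ q : Fin 2 → ℝ, h (Real.sqrt (z ^2 + (q 0^2 + q 1 ^2)), z) =
        ∫⁻ q : ℝ × ℝ, h (Real.sqrt (z ^2 + (q.1^2 + q.2 ^2)), z) := by
      rw [← (volume_preserving_finTwoArrow ℝ).lintegral_comp (by fun_prop)]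
      rfl
    rw [a1, polar2 (fun t => h (Real.sqrt (z^2 + t), z)) (by fun_prop)]
    have := subst_r z (fun r => h (r, z))
    simp only [add_comm (z^2)]
    rw [this, ← lintegral_const_mul _ (by fun_prop), ← lintegral_indicator measurableSet_Ioi]
    apply lintegral_congr
    intro r
    by_cases hr : |z| < r
    · simp [Set.indicator, hr, ENNReal.ofReal_mul Real.pi_pos.le, mul_assoc]
    · simp [Set.indicator, hr]
  simp only [e3]
  rw [Measure.volume_eq_prod, lintegral_prod_symm]
  apply Measurable.aemeasurable
  apply Measurable.mul _ hh
  apply Measurable.indicator (by fun_prop)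
  exact measurableSet_lt (by fun_prop) (by fun_prop)

lemma meas_w : Measurable ({p : ℝ × ℝ | |p.2| < p.1}.indicator
      (fun p => ENNReal.ofReal (2 * Real.pi * p.1))) := by
  apply Measurable.indicator (by fun_prop)
  exact measurableSet_lt (by fun_prop) (by fun_prop)

lemma map3 : Measure.map (fun x : E3 => (‖x‖, x 0)) volume =
    (volume : Measure (ℝ × ℝ)).withDensity ({p : ℝ × ℝ | |p.2| < p.1}.indicator
      (fun p => ENNReal.ofReal (2 * Real.pi * p.1))) := by
  refine Measure.ext fun (s : Set (ℝ × ℝ)) hs => ?_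
  have hT : Measurable (fun x : E3 => (‖x‖, x 0)) := by fun_prop
  rw [Measure.map_apply hT hs, withDensity_apply _ hs]
  have := lint3 (s.indicator 1) (measurable_one.indicator hs)
  rw [← lintegral_indicator hs]
  rw [← lintegral_indicator_one (hT hs)]
  refine Eq.trans (Eq.trans ?_ this) ?_
  · rfl
  · apply lintegral_congr
    intro p
    by_cases hp : p ∈ s <;> simp [hp]

lemma int3 (Φ : ℝ × ℝ → ℂ) (hΦ : Measurable Φ) :
    ∫ x : E3, Φ (‖x‖, x 0) = ∫ p : ℝ × ℝ, {p : ℝ × ℝ | |p.2| < p.1}.indicator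
      (fun p => (2 * Real.pi * p.1 : ℂ) * Φ p) p := by
  have hT : Measurable (fun x : E3 => (‖x‖, x 0)) := by fun_prop
  rw [← integral_map (φ := fun x : E3 => (‖x‖, x 0)) (f := Φ) hT.aemeasurable
    hΦ.aestronglyMeasurable, map3, integral_withDensity_eq_integral_toReal_smul meas_w]
  · congr 1
    ext p
    by_cases hp : |p.2| < p.1
    · have : 0 < p.1 := lt_of_le_of_lt (abs_nonneg _) hp
      simp [Set.indicator, hp, ENNReal.toReal_ofReal, this.le, Real.pi_pos.le]
    · simp [Set.indicator, hp]
  · refine ae_of_all _ fun p => ?_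
    by_cases hp : |p.2| < p.1 <;> simp [Set.indicator, hp]

lemma rot (y : E3) (hy : y ≠ 0) (F : ℝ → ℝ → ℂ) :
    ∫ x : E3, F ‖x‖ ‖x - y‖ =
    ∫ x : E3, F ‖x‖ (Real.sqrt (‖x‖^2 - 2 * ‖y‖ * x 0 + ‖y‖^2)) := by
  have hy' : ‖y‖ ≠ 0 := norm_ne_zero_iff.2 hy
  have ho : Orthonormal ℝ (({0} : Set (Fin 3)).domRestrict (fun _ : Fin 3 => (‖y‖⁻¹ • y : E3))) := by
    constructor
    · intro i
      simp [norm_smul, hy']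
    · intro i j hij
      exact absurd (Subsingleton.elim i j) hij
  obtain ⟨b, hb⟩ := ho.exists_orthonormalBasis_extension_of_card_eq (by simp)
  have hb0 := hb 0 rfl
  have h := b.measurePreserving_repr
  rw [← h.integral_comp b.repr.toHomeomorph.measurableEmbedding
    (fun x : E3 => F ‖x‖ (Real.sqrt (‖x‖^2 - 2 * ‖y‖ * x 0 + ‖y‖^2)))]
  congr 1
  ext x
  rw [b.repr.norm_map]
  congr 1
  rw [b.repr_apply_apply, hb0, real_inner_smul_left, real_inner_comm]
  have e : ‖x‖^2 - 2 * ‖y‖ * (‖y‖⁻¹ * inner ℝ x y) + ‖y‖^2 = ‖x - y‖^2 := by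
    rw [norm_sub_sq_real]
    field_simp
  rw [e, Real.sqrt_sq (norm_nonneg _)]

def Psi (c d : ℂ) (R : ℝ) (p : ℝ × ℝ) : ℂ :=
  {p : ℝ × ℝ | |p.2| < p.1}.indicator (fun p => (2 * Real.pi * p.1 : ℂ) *
    (Complex.exp (d * p.1) / p.1 * (Complex.exp (c * (Real.sqrt (p.1^2 - 2*R*p.2 + R^2) : ℝ)) /
      (Real.sqrt (p.1^2 - 2*R*p.2 + R^2) : ℝ)))) p

def VV (c d : ℂ) (R r : ℝ) : ℂ :=
  2 * Real.pi * Complex.exp (d * r) *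
   ((Complex.exp (c * (r + R : ℝ)) - Complex.exp (c * (|r - R| : ℝ))) / (R * c))

lemma Psi_pos (c d : ℂ) (R r : ℝ) (hr : 0 < r) :
    (fun z => Psi c d R (r, z)) = (Set.Ioo (-r) r).indicator (fun z =>
     (2 * Real.pi * Complex.exp (d * r)) *
     (Complex.exp (c * (Real.sqrt (r^2 - 2*R*z + R^2) : ℝ)) /
      (Real.sqrt (r^2 - 2*R*z + R^2) : ℝ))) := by
  ext z
  have hr' : (r : ℂ) ≠ 0 := by exact_mod_cast hr.ne'
  by_cases hz : |z| < r
  · have hz' : z ∈ Set.Ioo (-r) r := abs_lt.1 hz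
    rw [Set.indicator_of_mem hz', Psi, Set.indicator_of_mem (by exact hz)]
    simp only
    generalize Complex.exp (c * (Real.sqrt (r^2 - 2*R*z + R^2) : ℝ)) /
      (Real.sqrt (r^2 - 2*R*z + R^2) : ℝ) = A
    field_simp
  · have hz' : z ∉ Set.Ioo (-r) r := fun h => hz (abs_lt.2 h)
    rw [Set.indicator_of_notMem hz', Psi, Set.indicator_of_notMem (by exact hz)]

lemma Psi_neg (c d : ℂ) (R r : ℝ) (hr : r ≤ 0) (z : ℝ) : Psi c d R (r, z) = 0 := by
  rw [Psi, Set.indicator_of_notMem]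
  intro h
  have h : |z| < r := h
  linarith [abs_nonneg z]

lemma Psi_slice_integrable (c d : ℂ) (R r : ℝ) (hR : 0 < R) (hrR : r ≠ R) :
    Integrable (fun z => Psi c d R (r, z)) := by
  rcases le_or_gt r 0 with hr | hr
  · simp [Psi_neg c d R r hr]
  · rw [Psi_pos c d R r hr, integrable_indicator_iff measurableSet_Ioo]
    have := (inner_ii c R r hR hr hrR).const_mul (2 * Real.pi * Complex.exp (d * r))
    exact ((intervalIntegrable_iff_integrableOn_Ioo_of_le (by linarith)).1 this)

lemma Psi_slice (c d : ℂ) (hc : c ≠ 0) (R r : ℝ) (hR : 0 < R) (hrR : r ≠ R) :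
    ∫ z, Psi c d R (r, z) = (Set.Ioi 0).indicator (VV c d R) r := by
  rcases le_or_gt r 0 with hr | hr
  · simp [Psi_neg c d R r hr, hr]
  · rw [Psi_pos c d R r hr, integral_indicator measurableSet_Ioo, ← integral_Ioc_eq_integral_Ioo,
      ← intervalIntegral.integral_of_le (by linarith), intervalIntegral.integral_const_mul,
      inner_int c hc R r hR hr hrR, Set.indicator_of_mem (by exact hr), VV]

lemma Psi_norm (c d : ℂ) (b : ℝ) (hc : c.re = -b) (hd : d.re = -b) (R : ℝ) (p : ℝ × ℝ) :
    ((‖Psi c d R p‖ : ℝ) : ℂ) = Psi (-b : ℝ) (-b : ℝ) R p := by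
  unfold Psi
  by_cases hp : p ∈ {p : ℝ × ℝ | |p.2| < p.1}
  · have h0 : 0 < p.1 := lt_of_le_of_lt (abs_nonneg _) hp
    rw [Set.indicator_of_mem hp, Set.indicator_of_mem hp]
    simp only [norm_mul, norm_div, Complex.norm_exp, Complex.norm_real, Complex.re_mul_ofReal, hc, hd,
      Real.norm_eq_abs, abs_of_pos h0, abs_of_pos Real.pi_pos, abs_of_nonneg (Real.sqrt_nonneg _)]
    push_cast
    simp
  · rw [Set.indicator_of_notMem hp, Set.indicator_of_notMem hp]
    simp

lemma VV_cont (c d : ℂ) (R : ℝ) : Continuous (VV c d R) := by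
  unfold VV
  fun_prop

lemma VV_integrable (c d : ℂ) (hc : c.re < 0) (hd : d.re < 0) (R : ℝ) (hR : 0 < R) :
    IntegrableOn (VV c d R) (Set.Ioi 0) := by
  have h1 := (integrableOn_exp_mul_complex_Ioi hd 0)
  have h2 : IntegrableOn (fun r : ℝ => Complex.exp (d * r) * (Complex.exp (c * (r + R : ℝ)) - Complex.exp (c * (|r - R| : ℝ)))) (Set.Ioi 0) := by
    refine Integrable.mul_bdd (c := 2) h1 ?_ ?_
    · apply Continuous.aestronglyMeasurable
      fun_prop
    · rw [ae_restrict_iff' measurableSet_Ioi]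
      refine ae_of_all _ fun r hr => ?_
      have hr : 0 < r := hr
      refine (norm_sub_le _ _).trans ?_
      rw [Complex.norm_exp, Complex.norm_exp, Complex.re_mul_ofReal, Complex.re_mul_ofReal]
      have a1 : Real.exp (c.re * (r + R)) ≤ 1 := Real.exp_le_one_iff.2
        (mul_nonpos_of_nonpos_of_nonneg hc.le (by linarith))
      have a2 : Real.exp (c.re * |r - R|) ≤ 1 := Real.exp_le_one_iff.2
        (mul_nonpos_of_nonpos_of_nonneg hc.le (abs_nonneg _))
      linarith
  have h3 := h2.const_mul (2 * Real.pi / (R * c) : ℂ)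
  refine h3.congr (ae_of_all _ fun r => ?_)
  simp only [VV]
  ring

lemma Psi_meas (c d : ℂ) (R : ℝ) : Measurable (Psi c d R) := by
  unfold Psi
  apply Measurable.indicator (by fun_prop)
  exact measurableSet_lt (by fun_prop) (by fun_prop)

lemma ae_ne (R : ℝ) : ∀ᵐ r : ℝ, r ≠ R := by
  simp [ae_iff]

lemma Psi_integrable (c d : ℂ) (b : ℝ) (hb : 0 < b) (hc : c.re = -b) (hd : d.re = -b) (R : ℝ)
    (hR : 0 < R) : Integrable (Psi c d R) (volume.prod volume) := by
  rw [integrable_prod_iff (Psi_meas c d R).aestronglyMeasurable]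
  constructor
  · filter_upwards [ae_ne R] with r hr using Psi_slice_integrable c d R r hR hr
  · have h1 := (VV_integrable (-b : ℝ) (-b : ℝ) (by simpa) (by simpa) R hR)
    rw [← integrable_indicator_iff measurableSet_Ioi] at h1
    refine h1.re.congr ?_
    filter_upwards [ae_ne R] with r hr
    rw [← Psi_slice _ _ (by simpa using hb.ne') R r hR hr]
    simp only [← Psi_norm c d b hc hd]
    rw [integral_complex_ofReal]
    simp

lemma VV_integral (c d : ℂ) (b a : ℝ) (hb : 0 < b) (hc : c = -b - Complex.I * a)
    (hd : d = -b + Complex.I * a) (R : ℝ) (hR : 0 < R) :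
    ∫ r in Set.Ioi 0, VV c d R r = ((2 * Real.pi / b) * Real.exp (-b * R) *
        (if a * R = 0 then 1 else Real.sin (a * R) / (a * R)) : ℝ) := by
  have hcre : c.re = -b := by simp [hc]
  have hdre : d.re = -b := by simp [hd]
  have hc0 : c ≠ 0 := by
    intro h; rw [h] at hcre; simp at hcre; linarith
  have hR' : (R : ℂ) ≠ 0 := by exact_mod_cast hR.ne'
  have hb' : (b : ℂ) ≠ 0 := by exact_mod_cast hb.ne'
  have hI := VV_integrable c d (by linarith) (by linarith) R hR
  have hcd : (c + d).re < 0 := by simp [hcre, hdre]; linarith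
  have hcd' : c + d = -2 * b := by rw [hc, hd]; ring
  have hdc' : d - c = 2 * a * Complex.I := by rw [hc, hd]; ring
  have split : Set.Ioi (0:ℝ) = Set.Ioc 0 R ∪ Set.Ioi R := (Set.Ioc_union_Ioi_eq_Ioi hR.le).symm
  rw [split] at hI
  rw [split, setIntegral_union (Set.Ioc_disjoint_Ioi le_rfl) measurableSet_Ioi
    (hI.mono_set Set.subset_union_left) (hI.mono_set Set.subset_union_right)]
  have i1 : ∫ r in Set.Ioi R, VV c d R r = (2 * Real.pi / (R * c)) *
      (Complex.exp (c * R) - Complex.exp (-c * R)) * (Complex.exp ((c + d) * R) / (2 * b)) := by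
    have : ∀ r ∈ Set.Ioi R, VV c d R r = (2 * Real.pi / (R * c)) *
      (Complex.exp (c * R) - Complex.exp (-c * R)) * Complex.exp ((c + d) * r) := by
      intro r hr
      have hr : R < r := hr
      rw [VV, abs_of_pos (by linarith)]
      have e1 : Complex.exp (c * (r + R : ℝ)) = Complex.exp (c * r) * Complex.exp (c * R) := by
        rw [← Complex.exp_add]; push_cast; ring_nf
      have e2 : Complex.exp (c * (r - R : ℝ)) = Complex.exp (c * r) * Complex.exp (-c * R) := by
        rw [← Complex.exp_add]; push_cast; ring_nf
      rw [e1, e2, add_mul, Complex.exp_add]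
      ring
    rw [setIntegral_congr_fun measurableSet_Ioi this, integral_const_mul,
      integral_exp_mul_complex_Ioi hcd, hcd']
    congr 1
    field_simp
  have i2 : ∫ r in Set.Ioc 0 R, VV c d R r = (2 * Real.pi / (R * c)) * Complex.exp (c * R) *
      ((1 - Complex.exp ((c + d) * R)) / (2 * b) -
        ∫ r in (0:ℝ)..R, Complex.exp ((2 * a * Complex.I) * r)) := by
    have : ∀ r ∈ Set.uIcc 0 R, VV c d R r = (2 * Real.pi / (R * c)) * Complex.exp (c * R) *
      (Complex.exp ((c + d) * r) - Complex.exp ((2 * a * Complex.I) * r)) := by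
      intro r hr
      rw [Set.uIcc_of_le hR.le] at hr
      rw [VV, abs_of_nonpos (by linarith [hr.2])]
      have e1 : Complex.exp (c * (r + R : ℝ)) = Complex.exp (c * r) * Complex.exp (c * R) := by
        rw [← Complex.exp_add]; push_cast; ring_nf
      have e2 : Complex.exp (c * (-(r - R) : ℝ)) = Complex.exp (-c * r) * Complex.exp (c * R) := by
        rw [← Complex.exp_add]; push_cast; ring_nf
      rw [e1, e2, add_mul, Complex.exp_add, ← hdc',
        show (d - c) * (r : ℂ) = d * r + -c * r by ring, Complex.exp_add]
      ring
    rw [← intervalIntegral.integral_of_le hR.le, intervalIntegral.integral_congr this,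
      intervalIntegral.integral_const_mul, intervalIntegral.integral_sub
      (Continuous.intervalIntegrable (by fun_prop) _ _)
      (Continuous.intervalIntegrable (by fun_prop) _ _),
      integral_exp_mul_complex (by rw [hcd']; simpa using hb.ne'), hcd']
    congr 2
    simp
    field_simp
    ring
  rw [i1, i2]
  have f1 : Complex.exp (c * R) = Complex.exp (-b * R) * Complex.exp (-(a * R * Complex.I)) := by
    rw [← Complex.exp_add, hc]; ring_nf
  have f2 : Complex.exp (-c * R) * Complex.exp ((c + d) * R) =
      Complex.exp (-b * R) * Complex.exp (a * R * Complex.I) := by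
    rw [← Complex.exp_add, ← Complex.exp_add, hd]; ring_nf
  by_cases ha : a = 0
  · subst ha
    have : c = -b := by simp [hc]
    simp at f1 f2 ⊢
    have h3 : Complex.exp (-(c * R)) * Complex.exp ((c + d) * R) = Complex.exp (c * R) := by
      rw [f1, f2]
    rw [← f1]
    generalize Complex.exp (c * R) = X at *
    generalize Complex.exp (-(c * R)) = Y at *
    generalize Complex.exp ((c + d) * R) = Z at *
    subst this
    field_simp
    linear_combination h3
  · have ha' : (a : ℂ) ≠ 0 := by exact_mod_cast ha
    rw [if_neg (by simp [ha, hR.ne']), integral_exp_mul_complex (by simpa using ha)]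
    have f3 : Complex.exp (2 * a * Complex.I * R) * Complex.exp (-(a * R * Complex.I)) =
        Complex.exp (a * R * Complex.I) := by
      rw [← Complex.exp_add]; ring_nf
    push_cast
    rw [Complex.sin]
    rw [show -((a:ℂ) * R) * Complex.I = -(a * R * Complex.I) by ring]
    rw [f1]
    simp only [mul_zero, Complex.exp_zero]
    generalize Complex.exp (-(a * R * Complex.I)) = X at *
    generalize Complex.exp ((a * R * Complex.I)) = X' at *
    generalize Complex.exp (-c * R) = Y at *
    generalize Complex.exp ((c + d) * R) = Z at *
    generalize Complex.exp (2 * a * Complex.I * R) = W at *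
    generalize Complex.exp (-b * R) = B at *
    subst f3
    have : (2 * Real.pi / (R * c)) * (B * X) * ((1 - Z) / (2 * b) - (W - 1) / (2 * a * Complex.I)) +
      (2 * Real.pi / (R * c)) * (B * X - Y) * (Z / (2 * b)) = 
      (2 * Real.pi / (R * c)) * (B * X / (2 * b) - Y * Z / (2 * b) - B * X * (W - 1) / (2 * a * Complex.I)) := by
      ring
    rw [this, f2]
    have hI0 := Complex.I_ne_zero
    have hII := Complex.I_sq
    have : (a : ℂ) = Complex.I * (c + b) := by
      rw [hc]; linear_combination (a : ℂ) * hII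
    field_simp
    rw [this]
    ring_nf
    simp

/-- For `Im k > 0`,
`∫ (e^{ik|x|}/|x|) (e^{-i k̄ |x-y|}/|x-y|) dx
  = (2π/Im k) e^{-Im(k)|y|} sin(Re(k)|y|)/(Re(k)|y|)`,
where `sin t / t` is interpreted as `1` at `t = 0`. -/
theorem stmt3 (k : ℂ) (hk : 0 < k.im) (y : E3) :
    ∫ x : E3, (Complex.exp (Complex.I * k * ‖x‖) / (‖x‖ : ℂ)) *
        (Complex.exp (-Complex.I * (starRingEnd ℂ k) * ‖x - y‖) / (‖x - y‖ : ℂ)) =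
      ((2 * Real.pi / k.im) * Real.exp (-k.im * ‖y‖) *
        (if k.re * ‖y‖ = 0 then 1 else Real.sin (k.re * ‖y‖) / (k.re * ‖y‖)) : ℝ) := by
  have hc : -Complex.I * (starRingEnd ℂ k) = -k.im - Complex.I * k.re := by
    apply Complex.ext <;> simp
  have hd : Complex.I * k = -k.im + Complex.I * k.re := by
    apply Complex.ext <;> simp
  by_cases hy : y = 0
  · subst hy
    simp only [sub_zero, norm_zero, mul_zero, Real.exp_zero, if_true, mul_one]
    have := integral_fun_norm_addHaar (volume : Measure E3) (fun r : ℝ =>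
      (Complex.exp (Complex.I * k * r) / (r : ℂ)) *
        (Complex.exp (-Complex.I * (starRingEnd ℂ k) * r) / (r : ℂ)))
    rw [this]
    have h2 : ∀ r ∈ Set.Ioi (0:ℝ), r ^ (Module.finrank ℝ E3 - 1) •
      ((Complex.exp (Complex.I * k * r) / (r : ℂ)) *
        (Complex.exp (-Complex.I * (starRingEnd ℂ k) * r) / (r : ℂ))) =
        Complex.exp ((-2 * k.im : ℂ) * r) := by
      intro r hr
      have hr' : (r : ℂ) ≠ 0 := by
        have hr : 0 < r := hr
        exact_mod_cast hr.ne'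
      rw [div_mul_div_comm, ← Complex.exp_add, ← add_mul, hc, hd,
        show (-k.im + Complex.I * k.re + (-k.im - Complex.I * k.re) : ℂ) = -2 * k.im by ring]
      simp
      field_simp
    rw [setIntegral_congr_fun measurableSet_Ioi h2, integral_exp_mul_complex_Ioi (by simpa using hk)]
    rw [Measure.real, EuclideanSpace.volume_ball_fin_three]
    have hk' : (k.im : ℂ) ≠ 0 := by exact_mod_cast hk.ne'
    simp
    field_simp
    rw [ENNReal.toReal_ofReal (by positivity)]
    push_cast
    ring
  · have hR : 0 < ‖y‖ := norm_pos_iff.2 hy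
    rw [rot y hy (fun r s => (Complex.exp (Complex.I * k * r) / (r : ℂ)) *
        (Complex.exp (-Complex.I * (starRingEnd ℂ k) * s) / (s : ℂ)))]
    have h := int3 (fun p => (Complex.exp (Complex.I * k * p.1) / (p.1 : ℂ)) *
        (Complex.exp (-Complex.I * (starRingEnd ℂ k) *
         (Real.sqrt (p.1^2 - 2*‖y‖*p.2 + ‖y‖^2) : ℝ)) /
          ((Real.sqrt (p.1^2 - 2*‖y‖*p.2 + ‖y‖^2) : ℝ) : ℂ))) (by fun_prop)
    refine h.trans ?_
    change ∫ p : ℝ × ℝ, Psi (-Complex.I * (starRingEnd ℂ k)) (Complex.I * k) ‖y‖ p = _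
    have hcre : (-Complex.I * (starRingEnd ℂ k)).re = -k.im := by simp
    have hdre : (Complex.I * k).re = -k.im := by simp
    have hc0 : -Complex.I * (starRingEnd ℂ k) ≠ 0 := by
      intro h; rw [h] at hcre; simp at hcre; linarith
    rw [Measure.volume_eq_prod, integral_prod _ (Psi_integrable _ _ k.im hk hcre hdre _ hR)]
    rw [← VV_integral _ _ k.im k.re hk hc hd ‖y‖ hR, ← integral_indicator measurableSet_Ioi]
    apply integral_congr_ae
    filter_upwards [ae_ne ‖y‖] with r hr
    exact Psi_slice _ _ hc0 _ _ hR hr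
end
end

section
/- For k ∈ ℂ with Im(k) > 0 and g_k(x) = e^{ik|x|}/(4π|x|), one has ∫_{ℝ³} |g_k(x−y) − g_k(x)|² d³x ≤ (1/(4π)) · (1 + |Re(k)|/(2 Im(k))) · |y| for every y ∈ ℝ³. -/
open MeasureTheory
noncomputable section

/-- `g_k(x) = e^{ik|x|}/(4π|x|)`. -/
def gk (k : ℂ) (x : E3) : ℂ := Complex.exp (Complex.I * k * ‖x‖) / (4 * Real.pi * ‖x‖)


lemma coord_exists (y : E3) (hy : y ≠ 0) :
    ∃ T : ℝ × ℂ ≃ᵐ E3, MeasurePreserving T volume volume ∧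
      ∀ (z : ℝ) (w : ℂ) (c : ℝ), ‖T (z, w) + c • y‖ = √((z + c * ‖y‖) ^ 2 + ‖w‖ ^ 2) := by
  have hy' : ‖y‖ ≠ 0 := norm_ne_zero_iff.mpr hy
  obtain ⟨b, hb⟩ := Orthonormal.exists_orthonormalBasis_extension_of_card_eq (𝕜 := ℝ) (E := E3)
    (ι := Fin 3) (by simp) (v := fun _ => (‖y‖⁻¹) • y) (s := {0}) (by
      constructor
      · intro i
        simp [Set.domRestrict, norm_smul, hy']
      · intro i j hij
        exact absurd (Subsingleton.elim i j) hij)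
  have hb0 : y = ‖y‖ • b 0 := by
    rw [hb 0 rfl, smul_smul, mul_inv_cancel₀ hy', one_smul]
  let e1 : ℝ × ℂ ≃ᵐ ℝ × (Fin 2 → ℝ) :=
    (MeasurableEquiv.refl ℝ).prodCongr Complex.measurableEquivPi
  let e2 : (Fin 3 → ℝ) ≃ᵐ ℝ × (Fin 2 → ℝ) :=
    MeasurableEquiv.piFinSuccAbove (fun _ : Fin 3 => ℝ) 0
  have m1 : MeasurePreserving e1 volume volume :=
    (MeasurePreserving.id volume).prod Complex.volume_preserving_equiv_pi
  have m2 : MeasurePreserving e2 volume volume :=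
    volume_preserving_piFinSuccAbove (fun _ : Fin 3 => ℝ) 0
  refine ⟨((e1.trans e2.symm).trans (MeasurableEquiv.toLp 2 (Fin 3 → ℝ))).trans
    b.measurableEquiv.symm, ?_, ?_⟩
  · exact (((m1.trans (m2.symm e2)).trans (PiLp.volume_preserving_toLp (Fin 3))).trans
      (b.measurePreserving_measurableEquiv.symm _))
  · intro z w c
    rw [← LinearIsometryEquiv.norm_map b.repr, map_add, map_smul]
    have hyr : b.repr y = ‖y‖ • EuclideanSpace.single 0 1 := by
      conv_lhs => rw [hb0]
      rw [map_smul, b.repr_self]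
    rw [hyr]
    have : b.repr ((((e1.trans e2.symm).trans (MeasurableEquiv.toLp 2 (Fin 3 → ℝ))).trans
        b.measurableEquiv.symm) (z, w)) = !₂[z, w.re, w.im] := by
      change b.repr (b.repr.symm (WithLp.toLp 2 (e2.symm (z, ![w.re, w.im])))) = _
      rw [LinearIsometryEquiv.apply_symm_apply]
      congr 1
      rw [MeasurableEquiv.symm_apply_eq]
      rfl
    rw [this, EuclideanSpace.norm_eq]
    congr 1
    rw [Complex.sq_norm, Complex.normSq_apply]
    simp [Fin.sum_univ_three]
    ring

/-- integrand in cylindrical coordinates `(z, ρ^2)` -/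
def PP (a b r : ℝ) (p : ℝ × ℝ) : ℝ :=
  Real.exp (-b * (√((p.1 + r / 2) ^ 2 + p.2) + √((p.1 - r / 2) ^ 2 + p.2))) *
    Real.cos (a * (√((p.1 + r / 2) ^ 2 + p.2) - √((p.1 - r / 2) ^ 2 + p.2))) /
    (√((p.1 + r / 2) ^ 2 + p.2) * √((p.1 - r / 2) ^ 2 + p.2))

def psi (r : ℝ) (p : ℝ × ℝ) : ℝ × ℝ :=
  (p.1 * p.2 / (2 * r), (p.1 ^ 2 - r ^ 2) * (r ^ 2 - p.2 ^ 2) / (4 * r ^ 2))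

def dpsi (r : ℝ) (p : ℝ × ℝ) : ℝ × ℝ →L[ℝ] ℝ × ℝ :=
  (Matrix.toLin (.finTwoProd ℝ) (.finTwoProd ℝ)
    !![p.2 / (2 * r), p.1 / (2 * r);
      2 * p.1 * (r ^ 2 - p.2 ^ 2) / (4 * r ^ 2),
      -(2 * p.2 * (p.1 ^ 2 - r ^ 2)) / (4 * r ^ 2)]).toContinuousLinearMap

lemma dpsi_det (r : ℝ) (hr : 0 < r) (p : ℝ × ℝ) :
    (dpsi r p).det = -((p.1 ^ 2 - p.2 ^ 2) / (4 * r)) := by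
  unfold dpsi
  simp only [LinearMap.det_toContinuousLinearMap, LinearMap.det_toLin, Matrix.det_fin_two_of]
  field_simp
  ring

lemma hasFDerivAt_psi (r : ℝ) (p : ℝ × ℝ) : HasFDerivAt (psi r) (dpsi r p) p := by
  unfold dpsi
  rw [Matrix.toLin_finTwoProd_toContinuousLinearMap]
  have h1 : HasFDerivAt (fun p : ℝ × ℝ => p.1) (ContinuousLinearMap.fst ℝ ℝ ℝ) p := hasFDerivAt_fst
  have h2 : HasFDerivAt (fun p : ℝ × ℝ => p.2) (ContinuousLinearMap.snd ℝ ℝ ℝ) p := hasFDerivAt_snd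
  have := ((h1.mul h2).mul_const ((2 * r)⁻¹)).prodMk
    ((((h1.pow 2).sub_const (r ^ 2)).mul ((h2.pow 2).const_sub (r ^ 2))).mul_const ((4 * r ^ 2)⁻¹))
  refine (this.congr_fderiv ?_).congr_of_eventuallyEq ?_
  · ext <;> simp <;> ring
  · exact Filter.Eventually.of_forall fun p => by simp [psi, div_eq_mul_inv]

lemma psi_s (r : ℝ) (hr : 0 < r) (p : ℝ × ℝ) (hp : p ∈ Set.Ioi r ×ˢ Set.Ioo (-r) r) :
    √(((psi r p).1 + r / 2) ^ 2 + (psi r p).2) = (p.1 + p.2) / 2 := by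
  obtain ⟨h1, h2, h3⟩ := hp
  simp only [Set.mem_Ioi] at h1
  rw [Real.sqrt_eq_iff_mul_self_eq (by
    simp only [psi]
    have : 0 ≤ (p.1 ^ 2 - r ^ 2) * (r ^ 2 - p.2 ^ 2) :=
      mul_nonneg (by nlinarith) (by nlinarith)
    positivity) (by linarith)]
  simp only [psi]
  field_simp
  ring

lemma psi_t (r : ℝ) (hr : 0 < r) (p : ℝ × ℝ) (hp : p ∈ Set.Ioi r ×ˢ Set.Ioo (-r) r) :
    √(((psi r p).1 - r / 2) ^ 2 + (psi r p).2) = (p.1 - p.2) / 2 := by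
  obtain ⟨h1, h2, h3⟩ := hp
  simp only [Set.mem_Ioi] at h1
  rw [Real.sqrt_eq_iff_mul_self_eq (by
    simp only [psi]
    have : 0 ≤ (p.1 ^ 2 - r ^ 2) * (r ^ 2 - p.2 ^ 2) :=
      mul_nonneg (by nlinarith) (by nlinarith)
    positivity) (by linarith)]
  simp only [psi]
  field_simp
  ring

lemma psi_inj (r : ℝ) (hr : 0 < r) : Set.InjOn (psi r) (Set.Ioi r ×ˢ Set.Ioo (-r) r) := by
  intro p hp q hq h
  have a1 := psi_s r hr p hp
  have a2 := psi_t r hr p hp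
  rw [h] at a1 a2
  rw [psi_s r hr q hq] at a1
  rw [psi_t r hr q hq] at a2
  ext <;> linarith

lemma psi_image (r : ℝ) (hr : 0 < r) :
    psi r '' (Set.Ioi r ×ˢ Set.Ioo (-r) r) = Set.univ ×ˢ Set.Ioi 0 := by
  ext ⟨z, q⟩
  constructor
  · rintro ⟨p, ⟨h1, h2, h3⟩, h⟩
    simp only [Set.mem_Ioi] at h1
    refine ⟨trivial, ?_⟩
    have : q = (psi r p).2 := by rw [h]
    simp only [Set.mem_Ioi]
    rw [this]
    simp only [psi]
    have : 0 < (p.1 ^ 2 - r ^ 2) * (r ^ 2 - p.2 ^ 2) :=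
      mul_pos (by nlinarith) (by nlinarith)
    positivity
  · rintro ⟨-, hq⟩
    simp only [Set.mem_Ioi] at hq
    obtain ⟨s, hs⟩ : ∃ s, s = √((z + r / 2) ^ 2 + q) := ⟨_, rfl⟩
    obtain ⟨t, ht⟩ : ∃ t, t = √((z - r / 2) ^ 2 + q) := ⟨_, rfl⟩
    have hs0 : 0 < s := by rw [hs]; positivity
    have ht0 : 0 < t := by rw [ht]; positivity
    have hs2 : s ^ 2 = (z + r / 2) ^ 2 + q := by rw [hs]; exact Real.sq_sqrt (by positivity)
    have ht2 : t ^ 2 = (z - r / 2) ^ 2 + q := by rw [ht]; exact Real.sq_sqrt (by positivity)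
    have k1 : |z + r / 2| < s := abs_lt_of_sq_lt_sq (by linarith) hs0.le
    have k2 : |z - r / 2| < t := abs_lt_of_sq_lt_sq (by linarith) ht0.le
    rw [abs_lt] at k1 k2
    have hzz : s ^ 2 - t ^ 2 = 2 * r * z := by rw [hs2, ht2]; ring
    have hu : r < s + t := by linarith
    have key : (s * t) ^ 2 = (z ^ 2 - r ^ 2 / 4 + q) ^ 2 + q * r ^ 2 := by
      rw [mul_pow, hs2, ht2]; ring
    have key2 : z ^ 2 - r ^ 2 / 4 + q < s * t :=
      lt_of_le_of_lt (le_abs_self _)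
        (abs_lt_of_sq_lt_sq (by rw [key]; have : 0 < q * r ^ 2 := by positivity
                                linarith) (by positivity))
    have hv : |s - t| < r := abs_lt_of_sq_lt_sq (by nlinarith) hr.le
    rw [abs_lt] at hv
    refine ⟨(s + t, s - t), ⟨hu, hv.1, hv.2⟩, ?_⟩
    have e1 : (s + t) * (s - t) / (2 * r) = z := by
      rw [div_eq_iff (by positivity)]; linarith
    have e2 : ((s + t) ^ 2 - r ^ 2) * (r ^ 2 - (s - t) ^ 2) / (4 * r ^ 2) = q := by
      rw [div_eq_iff (by positivity)]
      have : ((s + t) ^ 2 - r ^ 2) * (r ^ 2 - (s - t) ^ 2)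
        = 2 * r ^ 2 * (s ^ 2 + t ^ 2) - (s ^ 2 - t ^ 2) ^ 2 - r ^ 4 := by ring
      rw [this, hzz, hs2, ht2]; ring
    simp only [psi, e1, e2]

lemma PP_psi (a b r : ℝ) (hr : 0 < r) (p : ℝ × ℝ) (hp : p ∈ Set.Ioi r ×ˢ Set.Ioo (-r) r) :
    |(dpsi r p).det| • PP a b r (psi r p) =
      (1 / r * Real.exp (-b * p.1)) * Real.cos (a * p.2) := by
  rw [dpsi_det r hr, abs_neg]
  unfold PP
  rw [psi_s r hr p hp, psi_t r hr p hp]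
  obtain ⟨h1, h2, h3⟩ := hp
  simp only [Set.mem_Ioi] at h1
  have hp1 : p.1 + p.2 ≠ 0 := by linarith
  have hp2 : p.1 - p.2 ≠ 0 := by linarith
  have : 0 ≤ p.1 ^ 2 - p.2 ^ 2 := by nlinarith
  rw [abs_of_nonneg (by positivity), smul_eq_mul]
  have e1 : (p.1 + p.2) / 2 + (p.1 - p.2) / 2 = p.1 := by ring
  have e2 : (p.1 + p.2) / 2 - (p.1 - p.2) / 2 = p.2 := by ring
  rw [e1, e2]
  have e3 : p.1 ^ 2 - p.2 ^ 2 = (p.1 + p.2) * (p.1 - p.2) := by ring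
  rw [e3]
  field_simp
  ring

lemma PP_integrable (a b r : ℝ) (hb : 0 < b) (hr : 0 < r) :
    IntegrableOn (PP a b r) (Set.univ ×ˢ Set.Ioi 0) (volume.prod volume) := by
  rw [← psi_image r hr]
  have hm : MeasurableSet (Set.Ioi r ×ˢ Set.Ioo (-r) r) := measurableSet_Ioi.prod measurableSet_Ioo
  rw [integrableOn_image_iff_integrableOn_abs_det_fderiv_smul (volume.prod volume) hm
    (fun x _ => (hasFDerivAt_psi r x).hasFDerivWithinAt) (psi_inj r hr)]
  rw [integrableOn_congr_fun (fun p hp => PP_psi a b r hr p hp) hm]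
  unfold IntegrableOn
  rw [← Measure.prod_restrict]
  refine Integrable.mul_prod (f := fun u => 1 / r * Real.exp (-b * u))
    (g := fun v => Real.cos (a * v)) ?_ ?_
  · exact (integrableOn_exp_mul_Ioi (by linarith) r).const_mul _
  · exact (Continuous.integrableOn_Icc (by fun_prop)).mono_set Set.Ioo_subset_Icc_self

lemma PP_integral (a b r : ℝ) (hb : 0 < b) (hr : 0 < r) :
    ∫ z : ℝ, ∫ q in Set.Ioi (0 : ℝ), PP a b r (z, q) =
      (Real.exp (-b * r) / (b * r)) * ∫ v in Set.Ioo (-r) r, Real.cos (a * v) := by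
  have h := setIntegral_prod (PP a b r) (PP_integrable a b r hb hr)
  rw [Measure.restrict_univ] at h
  rw [← h, ← psi_image r hr]
  have hm : MeasurableSet (Set.Ioi r ×ˢ Set.Ioo (-r) r) := measurableSet_Ioi.prod measurableSet_Ioo
  rw [integral_image_eq_integral_abs_det_fderiv_smul (volume.prod volume) hm
    (fun x _ => (hasFDerivAt_psi r x).hasFDerivWithinAt) (psi_inj r hr)]
  rw [setIntegral_congr_fun hm (fun p hp => PP_psi a b r hr p hp)]
  rw [setIntegral_prod_mul (fun u => 1 / r * Real.exp (-b * u)) (fun v => Real.cos (a * v))]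
  rw [integral_const_mul, integral_exp_mul_Ioi (by linarith)]
  congr 1
  field_simp

lemma cos_int_ge (a r : ℝ) (hr : 0 < r) :
    2 * r - |a| * r ^ 2 ≤ ∫ v in Set.Ioo (-r) r, Real.cos (a * v) := by
  rw [← integral_Ioc_eq_integral_Ioo, ← intervalIntegral.integral_of_le (by linarith)]
  have h1 : ∀ t : ℝ, 1 - |t| ≤ Real.cos t := by
    intro t
    rcases le_total |t| 2 with h | h
    · have := Real.one_sub_sq_div_two_le_cos (x := t)
      have h2 : t ^ 2 = |t| ^ 2 := (sq_abs t).symm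
      nlinarith [abs_nonneg t]
    · linarith [Real.neg_one_le_cos t]
  have h2 : ∫ v in (-r)..r, (1 - |a| * |v|) = 2 * r - |a| * r ^ 2 := by
    rw [intervalIntegral.integral_sub (by simp)
      (Continuous.intervalIntegrable (by fun_prop) _ _), intervalIntegral.integral_const_mul]
    have : ∫ v in (-r)..r, |v| = r ^ 2 := by
      rw [← intervalIntegral.integral_add_adjacent_intervals (b := 0)
        (Continuous.intervalIntegrable (by fun_prop) _ _)
        (Continuous.intervalIntegrable (by fun_prop) _ _)]
      have e1 : ∫ v in (-r)..0, |v| = ∫ v in (-r)..0, -v := by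
        apply intervalIntegral.integral_congr
        intro v hv
        rw [Set.uIcc_of_le (by linarith)] at hv
        exact abs_of_nonpos hv.2
      have e2 : ∫ v in (0)..r, |v| = ∫ v in (0)..r, v := by
        apply intervalIntegral.integral_congr
        intro v hv
        rw [Set.uIcc_of_le (by linarith)] at hv
        exact abs_of_nonneg hv.1
      rw [e1, e2, intervalIntegral.integral_neg, integral_id, integral_id]
      ring
    rw [this]
    simp
    ring
  rw [← h2]
  apply intervalIntegral.integral_mono_on (by linarith)
    (Continuous.intervalIntegrable (by fun_prop) _ _)
    (Continuous.intervalIntegrable (by fun_prop) _ _)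
  intro v _
  rw [← abs_mul]
  exact h1 _

lemma gk_eq (k : ℂ) (x : E3) : gk k x =
    ⟨Real.exp (-k.im * ‖x‖) * Real.cos (k.re * ‖x‖) / (4 * Real.pi * ‖x‖),
      Real.exp (-k.im * ‖x‖) * Real.sin (k.re * ‖x‖) / (4 * Real.pi * ‖x‖)⟩ := by
  unfold gk
  have h : (4 * (Real.pi : ℂ) * (‖x‖ : ℂ)) = ((4 * Real.pi * ‖x‖ : ℝ) : ℂ) := by push_cast; rfl
  rw [h]
  apply Complex.ext
  · rw [Complex.div_ofReal_re, Complex.exp_re]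
    simp
  · rw [Complex.div_ofReal_im, Complex.exp_im]
    simp

lemma gk_sq (k : ℂ) (x : E3) :
    ‖gk k x‖ ^ 2 = Real.exp (-(2 * k.im) * ‖x‖) / (4 * Real.pi * ‖x‖) ^ 2 := by
  rw [Complex.sq_norm, gk_eq, Complex.normSq_mk]
  have : Real.exp (-(2 * k.im) * ‖x‖) = Real.exp (-k.im * ‖x‖) ^ 2 := by
    rw [← Real.exp_nat_mul]; congr 1; push_cast; ring
  rw [this]
  have := Real.sin_sq_add_cos_sq (k.re * ‖x‖)
  rw [div_mul_div_comm, div_mul_div_comm, ← add_div, ← sq (4 * Real.pi * ‖x‖)]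
  congr 1
  linear_combination (Real.exp (-k.im * ‖x‖) ^ 2) * this

lemma gk_cross (k : ℂ) (x x' : E3) :
    (gk k x' * (starRingEnd ℂ) (gk k x)).re = (1 / (16 * Real.pi ^ 2)) *
      (Real.exp (-k.im * (‖x‖ + ‖x'‖)) * Real.cos (k.re * (‖x‖ - ‖x'‖)) / (‖x‖ * ‖x'‖)) := by
  rw [gk_eq, gk_eq, Complex.mul_re, Complex.conj_re, Complex.conj_im]
  simp only
  rw [mul_sub, Real.cos_sub, mul_add (-k.im), Real.exp_add]
  rw [div_mul_div_comm, mul_neg, div_mul_div_comm, sub_neg_eq_add, ← add_div,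
    div_mul_div_comm]
  congr 1 <;> ring

lemma gk_sq_integrable (k : ℂ) (hk : 0 < k.im) : Integrable (fun x : E3 => ‖gk k x‖ ^ 2) := by
  simp_rw [gk_sq]
  rw [integrable_fun_norm_addHaar volume
    (f := fun s => Real.exp (-(2 * k.im) * s) / (4 * Real.pi * s) ^ 2)]
  have : IntegrableOn (fun s : ℝ => (1 / (16 * Real.pi ^ 2)) * Real.exp (-(2 * k.im) * s))
      (Set.Ioi 0) := (integrableOn_exp_mul_Ioi (by linarith) 0).const_mul _
  refine this.congr_fun ?_ measurableSet_Ioi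
  intro s hs
  have hs' : s ≠ 0 := ne_of_gt hs
  have := Real.pi_ne_zero
  simp only [finrank_euclideanSpace, Fintype.card_fin, smul_eq_mul]
  norm_num
  field_simp
  norm_num

lemma gk_sq_integral (k : ℂ) (hk : 0 < k.im) :
    ∫ x : E3, ‖gk k x‖ ^ 2 = 1 / (8 * Real.pi * k.im) := by
  simp_rw [gk_sq]
  rw [integral_fun_norm_addHaar volume
    (f := fun s => Real.exp (-(2 * k.im) * s) / (4 * Real.pi * s) ^ 2)]
  have : ∫ s in Set.Ioi (0 : ℝ), s ^ (Module.finrank ℝ E3 - 1) •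
      (Real.exp (-(2 * k.im) * s) / (4 * Real.pi * s) ^ 2) =
      ∫ s in Set.Ioi (0 : ℝ), (1 / (16 * Real.pi ^ 2)) * Real.exp (-(2 * k.im) * s) := by
    refine setIntegral_congr_fun measurableSet_Ioi ?_
    intro s hs
    have hs' : s ≠ 0 := ne_of_gt hs
    have := Real.pi_ne_zero
    simp only [finrank_euclideanSpace, Fintype.card_fin, smul_eq_mul]
    norm_num
    field_simp
    norm_num
  rw [this, integral_const_mul, integral_exp_mul_Ioi (by linarith)]
  have h3 : (volume : Measure E3).real (Metric.ball 0 1) = Real.pi * 4 / 3 := by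
    rw [Measure.real, EuclideanSpace.volume_ball_fin_three]
    simp
    positivity
  rw [h3]
  have := Real.pi_ne_zero
  simp
  field_simp
  norm_num

lemma gk_measurable (k : ℂ) : Measurable (gk k) := by
  unfold gk
  fun_prop

lemma cross_integrable (k : ℂ) (hk : 0 < k.im) (y : E3) :
    Integrable (fun x : E3 => (gk k (x - y) * (starRingEnd ℂ) (gk k x)).re) := by
  have h1 := gk_sq_integrable k hk
  have h2 := h1.comp_sub_right y
  refine (h1.add h2).mono' ?_ ?_
  · have hm := gk_measurable k
    have : Measurable (fun x : E3 => (gk k (x - y) * (starRingEnd ℂ) (gk k x)).re) := by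
      have h3 : Measurable (fun x : E3 => gk k (x - y)) := hm.comp (by fun_prop)
      exact Complex.measurable_re.comp
        (h3.mul (Complex.continuous_conj.measurable.comp hm))
    exact this.aestronglyMeasurable
  · refine Filter.Eventually.of_forall fun x => ?_
    refine (Complex.abs_re_le_norm _).trans ?_
    rw [norm_mul, RCLike.norm_conj]
    simp only [Pi.add_apply]
    nlinarith [sq_nonneg (‖gk k x‖ - ‖gk k (x - y)‖), sq_nonneg (‖gk k x‖ ),
      sq_nonneg (‖gk k (x - y)‖)]

lemma cross_integral (k : ℂ) (hk : 0 < k.im) (y : E3) (hy : y ≠ 0) :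
    ∫ x : E3, (gk k (x - y) * (starRingEnd ℂ) (gk k x)).re =
      (1 / (16 * Real.pi)) * ((Real.exp (-k.im * ‖y‖) / (k.im * ‖y‖)) *
        ∫ v in Set.Ioo (-‖y‖) ‖y‖, Real.cos (k.re * v)) := by
  have hr : 0 < ‖y‖ := norm_pos_iff.mpr hy
  obtain ⟨T, hT, hN⟩ := coord_exists y hy
  have hI := (cross_integrable k hk y).comp_add_right ((1 / 2 : ℝ) • y)
  rw [← integral_add_right_eq_self _ ((1 / 2 : ℝ) • y)]
  rw [← hT.integral_comp T.measurableEmbedding]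
  have hI2 := (hT.integrable_comp_emb T.measurableEmbedding).mpr hI
  have key : ∀ p : ℝ × ℂ, (gk k (T p + (1 / 2 : ℝ) • y - y) *
      (starRingEnd ℂ) (gk k (T p + (1 / 2 : ℝ) • y))).re =
      (1 / (16 * Real.pi ^ 2)) * PP k.re k.im ‖y‖ (p.1, ‖p.2‖ ^ 2) := by
    rintro ⟨z, w⟩
    have e : T (z, w) + (1 / 2 : ℝ) • y - y = T (z, w) + (-1 / 2 : ℝ) • y := by
      module
    rw [gk_cross, e, hN, hN]
    have e1 : z + (1 / 2 : ℝ) * ‖y‖ = z + ‖y‖ / 2 := by ring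
    have e2 : z + (-1 / 2 : ℝ) * ‖y‖ = z - ‖y‖ / 2 := by ring
    rw [e1, e2]
    rfl
  have hI3 : Integrable (fun p : ℝ × ℂ =>
      (1 / (16 * Real.pi ^ 2)) * PP k.re k.im ‖y‖ (p.1, ‖p.2‖ ^ 2)) (volume.prod volume) := by
    refine hI2.congr (Filter.Eventually.of_forall fun p => ?_)
    exact key p
  simp_rw [key]
  rw [Measure.volume_eq_prod, integral_prod _ hI3]
  simp_rw [integral_const_mul]
  have inner : ∀ z : ℝ, ∫ w : ℂ, PP k.re k.im ‖y‖ (z, ‖w‖ ^ 2) =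
      Real.pi * ∫ q in Set.Ioi (0 : ℝ), PP k.re k.im ‖y‖ (z, q) := by
    intro z
    rw [integral_fun_norm_addHaar volume (f := fun s => PP k.re k.im ‖y‖ (z, s ^ 2))]
    rw [← integral_comp_rpow_Ioi (fun q => PP k.re k.im ‖y‖ (z, q)) (p := 2) two_ne_zero]
    have h3 : (volume : Measure ℂ).real (Metric.ball 0 1) = Real.pi := by
      rw [Measure.real, Complex.volume_ball]
      simp
    rw [h3, Complex.finrank_real_complex]
    simp only [smul_eq_mul, nsmul_eq_mul]
    rw [mul_left_comm, ← integral_const_mul]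
    congr 1
    refine setIntegral_congr_fun measurableSet_Ioi ?_
    intro s _
    norm_num
    ring
  simp_rw [inner, integral_const_mul]
  rw [PP_integral _ _ _ hk hr]
  have := Real.pi_ne_zero
  field_simp

/-- For `Im k > 0`,
`∫ |g_k(x-y) - g_k(x)|² dx ≤ (1/4π)(1 + |Re k|/(2 Im k)) |y|`. -/
theorem stmt4 (k : ℂ) (hk : 0 < k.im) (y : E3) :
    ∫ x : E3, ‖gk k (x - y) - gk k x‖ ^ 2 ≤
      (1 / (4 * Real.pi)) * (1 + |k.re| / (2 * k.im)) * ‖y‖ := by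
  rcases eq_or_ne y 0 with rfl | hy
  · simp
  have hr : 0 < ‖y‖ := norm_pos_iff.mpr hy
  have h1 := gk_sq_integrable k hk
  have h2 := h1.comp_sub_right y
  have h3 := cross_integrable k hk y
  have e : ∀ x : E3, ‖gk k (x - y) - gk k x‖ ^ 2 = ‖gk k (x - y)‖ ^ 2 + ‖gk k x‖ ^ 2 -
      2 * (gk k (x - y) * (starRingEnd ℂ) (gk k x)).re := by
    intro x
    simp only [Complex.sq_norm, Complex.normSq_sub]
  simp_rw [e]
  have h12 : Integrable (fun x : E3 => ‖gk k (x - y)‖ ^ 2 + ‖gk k x‖ ^ 2) := h2.add h1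
  rw [integral_sub h12 (h3.const_mul 2), integral_add h2 h1,
    integral_sub_right_eq_self (fun x => ‖gk k x‖ ^ 2), integral_const_mul,
    gk_sq_integral k hk, cross_integral k hk y hy]
  have hc := cos_int_ge k.re ‖y‖ hr
  generalize (∫ v in Set.Ioo (-‖y‖) ‖y‖, Real.cos (k.re * v)) = J at hc
  generalize ‖y‖ = r at *
  generalize k.im = b at *
  have ha : 0 ≤ |k.re| := abs_nonneg _
  generalize |k.re| = a at *
  have hE1 : Real.exp (-b * r) ≤ 1 := Real.exp_le_one_iff.mpr (by nlinarith)
  have hE2 : 1 - b * r ≤ Real.exp (-b * r) := by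
    have := Real.add_one_le_exp (-b * r); linarith
  have hE0 := Real.exp_pos (-b * r)
  generalize Real.exp (-b * r) = E at *
  have hpi := Real.pi_pos
  have hfin : 2 * r - E * J ≤ 2 * b * r ^ 2 + a * r ^ 2 := by
    have s1 : E * (2 * r - a * r ^ 2) ≤ E * J := mul_le_mul_of_nonneg_left hc hE0.le
    have s2 : E * (a * r ^ 2) ≤ 1 * (a * r ^ 2) :=
      mul_le_mul_of_nonneg_right hE1 (by positivity)
    have s3 : (1 - b * r) * (2 * r) ≤ E * (2 * r) :=
      mul_le_mul_of_nonneg_right hE2 (by positivity)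
    nlinarith
  have l : 1 / (8 * Real.pi * b) + 1 / (8 * Real.pi * b) -
      2 * (1 / (16 * Real.pi) * (E / (b * r) * J)) =
      (2 * r - E * J) / (8 * Real.pi * b * r) := by
    field_simp
    ring
  have rr : 1 / (4 * Real.pi) * (1 + a / (2 * b)) * r =
      (2 * b * r ^ 2 + a * r ^ 2) / (8 * Real.pi * b * r) := by
    field_simp
    ring
  rw [l, rr]
  gcongr
end
end
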